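/- arXiv:0711.2489 — 2 statements merged into one kernel-verified Lean document; each statement's English description precedes it below -/
import Mathlib

section
/- Let ≽ be a binary relation on ℝ^n, n ≥ 2. The following are equivalent: (1) ≽ satisfies A1 (total preorder), A2 (continuity), A3 (symmetry), A4 (weak independence), A5 (monotonicity), A6 (non-triviality) and A7 (order-preserving transfer); (2) there is a unique at most 2-additive symmetric capacity μ on X = {1,…,n} (i.e. its Möbius transform vanishes on all sets of cardinality greater than 2) such that ≽ is represented by the Choquet integral C_μ. -/
open Finset

/-- A capacity on `X = {1,…,n}` (modelled as `Fin n`). -/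
def IsCapacity {n : ℕ} (μ : Finset (Fin n) → ℝ) : Prop :=
  μ ∅ = 0 ∧ μ Finset.univ = 1 ∧ ∀ A B : Finset (Fin n), A ⊆ B → μ A ≤ μ B

/-- A symmetric capacity: the value depends only on the cardinality. -/
def IsSymmetricCap {n : ℕ} (μ : Finset (Fin n) → ℝ) : Prop :=
  ∀ A B : Finset (Fin n), A.card = B.card → μ A = μ B

/-- The Möbius transform of a set function. -/
noncomputable def mobius {n : ℕ} (μ : Finset (Fin n) → ℝ) (A : Finset (Fin n)) : ℝ :=
  ∑ B ∈ A.powerset, (-1 : ℝ) ^ (A.card - B.card) * μ B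

/-- `μ` is at most `k`-additive: its Möbius transform vanishes on sets of more than `k` elements. -/
def AtMostAdditive {n : ℕ} (k : ℕ) (μ : Finset (Fin n) → ℝ) : Prop :=
  ∀ A : Finset (Fin n), k < A.card → mobius μ A = 0

/-- The Choquet integral of the act `f` with respect to `μ`:
`C_μ(f) = Σ_i (f_(i) - f_(i-1)) μ(B_i)` with `f_(0) = 0`, where the increasing rearrangement
is obtained through the sorting permutation `Tuple.sort f`, and `B_i = {σ(i),…,σ(n)}`. -/
noncomputable def choquet {n : ℕ} (μ : Finset (Fin n) → ℝ) (f : Fin n → ℝ) : ℝ :=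
  ∑ i : Fin n,
    (f (Tuple.sort f i) -
      if (i : ℕ) = 0 then 0
      else f (Tuple.sort f ⟨(i : ℕ) - 1, lt_of_le_of_lt (Nat.sub_le _ _) i.isLt⟩)) *
    μ ((Finset.univ.filter fun j : Fin n => i ≤ j).image (Tuple.sort f))

/-- The OWA operator with weights `w`: `Σ_i w_i f_(i)`. -/
noncomputable def owa {n : ℕ} (w f : Fin n → ℝ) : ℝ :=
  ∑ i : Fin n, w i * f (Tuple.sort f i)

/-- `w` is the weight vector of the symmetric capacity `μ`:
`μ(T) = Σ_{i = n - |T| + 1}^{n} w_i` (1-based), i.e. the sum of the last `|T|` weights. -/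
def IsWeightOf {n : ℕ} (w : Fin n → ℝ) (μ : Finset (Fin n) → ℝ) : Prop :=
  ∀ T : Finset (Fin n), T.Nonempty →
    μ T = ∑ i ∈ Finset.univ.filter (fun i : Fin n => n - T.card ≤ (i : ℕ)), w i

/-- `w` viewed with natural-number (0-based) indices, junk value `0` out of range
(never used in the statements below). -/
noncomputable def wAt {n : ℕ} (w : Fin n → ℝ) (i : ℕ) : ℝ :=
  if h : i < n then w ⟨i, h⟩ else 0

/-- The alternating sum `Σ_{j=0}^{k-1} (-1)^j C(k-1,j) w_{i+j}`, with `i` a 1-based index. -/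
noncomputable def altSum {n : ℕ} (w : Fin n → ℝ) (k i : ℕ) : ℝ :=
  ∑ j ∈ Finset.range k, (-1 : ℝ) ^ j * ((k - 1).choose j : ℝ) * wAt w (i - 1 + j)

/-- A preference relation on acts. -/
abbrev Pref (n : ℕ) := (Fin n → ℝ) → (Fin n → ℝ) → Prop

/-- Asymmetric (strict) part of a preference relation. -/
def StrictP {n : ℕ} (R : Pref n) (f g : Fin n → ℝ) : Prop := R f g ∧ ¬ R g f

/-- Symmetric (indifference) part of a preference relation. -/
def IndiffP {n : ℕ} (R : Pref n) (f g : Fin n → ℝ) : Prop := R f g ∧ R g f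

/-- `V` represents `≽`: `f ≽ g ↔ V f ≥ V g`. -/
def Represents {n : ℕ} (V : (Fin n → ℝ) → ℝ) (R : Pref n) : Prop :=
  ∀ f g, R f g ↔ V g ≤ V f

/-- A1: weak order (complete, reflexive, transitive). -/
def AxA1 {n : ℕ} (R : Pref n) : Prop :=
  (∀ f g, R f g ∨ R g f) ∧ (∀ f, R f f) ∧ (∀ f g h, R f g → R g h → R f h)

/-- A2: continuity, the strict upper and lower contour sets are open. -/
def AxA2 {n : ℕ} (R : Pref n) : Prop :=
  ∀ f, IsOpen {g | StrictP R g f} ∧ IsOpen {g | StrictP R f g}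

/-- A3: symmetry under permutations. -/
def AxA3 {n : ℕ} (R : Pref n) : Prop :=
  ∀ (f : Fin n → ℝ) (π : Equiv.Perm (Fin n)), IndiffP R f (f ∘ π)

/-- A4: weak independence of income source (on nondecreasing acts). -/
def AxA4 {n : ℕ} (R : Pref n) : Prop :=
  ∀ f g h : Fin n → ℝ, Monotone f → Monotone g → Monotone h →
    (R f g ↔ R (f + h) (g + h))

/-- A5: monotonicity. -/
def AxA5 {n : ℕ} (R : Pref n) : Prop :=
  ∀ f g : Fin n → ℝ, (∀ i, g i ≤ f i) → R f g

/-- A6: non-triviality. -/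
def AxA6 {n : ℕ} (R : Pref n) : Prop :=
  ∃ f g, StrictP R f g

/-- `i` `f`-precedes `j` : `f i < f j` and no value of `f` lies strictly between them. -/
def Precedes {n : ℕ} (f : Fin n → ℝ) (i j : Fin n) : Prop :=
  f i < f j ∧ ∀ l, ¬ (f i < f l ∧ f l < f j)

/-- A7: order-preserving transfer. -/
def AxA7 {n : ℕ} (R : Pref n) : Prop :=
  ∀ (f f' g g' : Fin n → ℝ) (i j : Fin n) (t : ℝ), 0 < t →
    Precedes f i j → Precedes g i j → Precedes f' i j → Precedes g' i j →
    f' i = f i + t → g' i = g i + t → f' j = f j - t → g' j = g j - t →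
    (∀ l, l ≠ i → l ≠ j → f' l = f l) → (∀ l, l ≠ i → l ≠ j → g' l = g l) →
    (R f g ↔ R f' g')

/-- A8: inequality aversion. -/
def AxA8 {n : ℕ} (R : Pref n) : Prop :=
  ∀ (f f' : Fin n → ℝ), Monotone f → Monotone f' →
    ∀ (i : Fin n) (hi : (i : ℕ) + 1 < n) (t : ℝ), 0 < t →
      f' i = f i + t → f' ⟨(i : ℕ) + 1, hi⟩ = f ⟨(i : ℕ) + 1, hi⟩ - t →
      (∀ j, j ≠ i → j ≠ (⟨(i : ℕ) + 1, hi⟩ : Fin n) → f' j = f j) →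
      StrictP R f' f

/-- Comonotone acts. -/
def Comonotone {n : ℕ} (f g : Fin n → ℝ) : Prop :=
  ∀ i j, 0 ≤ (f i - f j) * (g i - g j)

/-- The chain condition: (0-based) index `i` `f`-precedes `i+1`, which `f`-precedes `i+2`, …,
which `f`-precedes `i+k`. -/
def PrecChain {n : ℕ} (f : Fin n → ℝ) (i k : ℕ) (h : i + k < n) : Prop :=
  ∀ r, ∀ _hr : r < k, Precedes f ⟨i + r, by omega⟩ ⟨i + r + 1, by omega⟩

/-- A7(k): k-dimensional order-preserving transfer. -/
def AxA7k {n : ℕ} (k : ℕ) (R : Pref n) : Prop :=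
  ∀ (f g f' g' : Fin n → ℝ) (i : ℕ) (hik : i + k < n) (t : ℝ), 0 < t →
    PrecChain f i k hik → PrecChain g i k hik →
    PrecChain f' i k hik → PrecChain g' i k hik →
    (∀ j, ∀ _hj : j < k, f' ⟨i + j, by omega⟩ =
      f ⟨i + j, by omega⟩ + (-1 : ℝ) ^ j * ((k - 1).choose j : ℝ) * t) →
    (∀ j, ∀ _hj : j < k, g' ⟨i + j, by omega⟩ =
      g ⟨i + j, by omega⟩ + (-1 : ℝ) ^ j * ((k - 1).choose j : ℝ) * t) →
    (∀ l : Fin n, ((l : ℕ) < i ∨ i + k ≤ (l : ℕ)) → f' l = f l) →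
    (∀ l : Fin n, ((l : ℕ) < i ∨ i + k ≤ (l : ℕ)) → g' l = g l) →
    Comonotone f f' → Comonotone g g' →
    (R f g ↔ R f' g')

/-- The act `f^B`: add `t` to the coordinates in `B`, keep the others. -/
def shiftAct {n : ℕ} (f : Fin n → ℝ) (t : ℝ) (B : Finset (Fin n)) : Fin n → ℝ :=
  fun l => if l ∈ B then f l + t else f l

/-- A9: asymmetric order-preserving transfer (2-dimensional). -/
def AxA9 {n : ℕ} (R : Pref n) : Prop :=
  ∃ H : (Fin n → ℝ) → ℝ, Represents H R ∧
    ∀ i j : Fin n, i ≠ j → ∀ f g : Fin n → ℝ, f i = f j → g i = g j →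
      ∀ t : ℝ, 0 < t →
      (∀ B ∈ ({i, j} : Finset (Fin n)).powerset, Comonotone f (shiftAct f t B)) →
      (∀ B ∈ ({i, j} : Finset (Fin n)).powerset, Comonotone g (shiftAct g t B)) →
      ∑ B ∈ ({i, j} : Finset (Fin n)).powerset, (-1 : ℝ) ^ B.card * H (shiftAct f t B) =
        ∑ B ∈ ({i, j} : Finset (Fin n)).powerset, (-1 : ℝ) ^ B.card * H (shiftAct g t B)

/-- A9(k): k-dimensional asymmetric order-preserving transfer. -/
def AxA9k {n : ℕ} (k : ℕ) (R : Pref n) : Prop :=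
  ∃ H : (Fin n → ℝ) → ℝ, Represents H R ∧
    ∀ S : Finset (Fin n), S.card = k →
      ∀ f g : Fin n → ℝ, (∀ i ∈ S, ∀ j ∈ S, f i = f j) → (∀ i ∈ S, ∀ j ∈ S, g i = g j) →
        ∀ t : ℝ, 0 < t →
        (∀ B ∈ S.powerset, Comonotone f (shiftAct f t B)) →
        (∀ B ∈ S.powerset, Comonotone g (shiftAct g t B)) →
        ∑ B ∈ S.powerset, (-1 : ℝ) ^ B.card * H (shiftAct f t B) =
          ∑ B ∈ S.powerset, (-1 : ℝ) ^ B.card * H (shiftAct g t B)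

/-! ### Cardinality-based set functions and their Möbius transform -/

lemma mobius_eq_sum_range {n : ℕ} {μ : Finset (Fin n) → ℝ} {v : ℕ → ℝ}
    (hμ : ∀ A, μ A = v A.card) (A : Finset (Fin n)) :
    mobius μ A =
      ∑ m ∈ range (A.card + 1), (A.card.choose m : ℝ) * ((-1 : ℝ) ^ (A.card - m) * v m) := by
  unfold mobius
  simp only [hμ]
  rw [Finset.sum_powerset_apply_card (fun m => (-1 : ℝ) ^ (A.card - m) * v m)]
  simp [nsmul_eq_mul]

lemma alternating_sum_quadratic_eq_zero (a b : ℝ) {m : ℕ} (hm : 2 < m) :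
    ∑ k ∈ range (m + 1),
      (m.choose k : ℝ) * ((-1 : ℝ) ^ (m - k) * (a * (k : ℝ) + b * (k : ℝ) ^ 2)) = 0 := by
  have h := congrFun (fwdDiff_iter_sum_mul_pow_eq_zero (R := ℝ) (n := m)
    (fun k => if k = 1 then a else if k = 2 then b else 0)) 0
  rw [fwdDiff_iter_eq_sum_shift] at h
  rw [Pi.zero_apply] at h
  rw [← h]
  refine Finset.sum_congr rfl fun k _ => ?_
  have h2 : ∑ j ∈ range m, (if j = 1 then a else if j = 2 then b else 0) *
      (0 + k • (1 : ℝ)) ^ j = a * (k : ℝ) + b * (k : ℝ) ^ 2 := by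
    rw [← Finset.sum_subset (s₁ := {1, 2})]
    · simp
    · intro x hx
      simp only [mem_insert, mem_singleton] at hx
      rw [mem_range]
      omega
    · intro x _ hx
      simp only [mem_insert, mem_singleton, not_or] at hx
      simp [hx.1, hx.2]
  rw [h2]
  simp only [zsmul_eq_mul]
  push_cast
  ring

lemma atMostAdditive_two_of_quadratic {n : ℕ} {μ : Finset (Fin n) → ℝ} {a b : ℝ}
    (hμ : ∀ A, μ A = a * (A.card : ℝ) + b * (A.card : ℝ) ^ 2) : AtMostAdditive 2 μ := by
  intro A hA
  rw [mobius_eq_sum_range (v := fun k => a * (k : ℝ) + b * (k : ℝ) ^ 2) hμ A]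
  exact alternating_sum_quadratic_eq_zero a b hA

lemma quadratic_of_atMostAdditive_two {n : ℕ} {μ : Finset (Fin n) → ℝ} {v : ℕ → ℝ}
    (hμ : ∀ A, μ A = v A.card) (hv : v 0 = 0) (h : AtMostAdditive 2 μ) :
    ∃ a b : ℝ, ∀ k ≤ n, v k = a * (k : ℝ) + b * (k : ℝ) ^ 2 := by
  refine ⟨2 * v 1 - v 2 / 2, v 2 / 2 - v 1, fun k => ?_⟩
  induction k using Nat.strong_induction_on with
  | _ k ih =>
    intro hk
    rcases Nat.lt_or_ge 2 k with h2 | h2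
    · obtain ⟨A, -, hA⟩ := Finset.exists_subset_card_eq
        (s := (Finset.univ : Finset (Fin n))) (n := k) (by simpa using hk)
      have h1 := h A (by omega)
      rw [mobius_eq_sum_range hμ, hA, Finset.sum_range_succ] at h1
      have h3 := alternating_sum_quadratic_eq_zero (2 * v 1 - v 2 / 2) (v 2 / 2 - v 1) h2
      rw [Finset.sum_range_succ] at h3
      rw [Finset.sum_congr rfl fun m hm => by
        rw [ih m (mem_range.1 hm) (by have := mem_range.1 hm; omega)]] at h1
      simp only [Nat.choose_self, Nat.sub_self, pow_zero, Nat.cast_one, one_mul] at h1 h3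
      linarith
    · interval_cases k
      · simp [hv]
      · push_cast; ring
      · push_cast; ring

lemma exists_card_form {n : ℕ} {μ : Finset (Fin n) → ℝ} (h : IsSymmetricCap μ) :
    ∃ v : ℕ → ℝ, ∀ A, μ A = v A.card := by
  classical
  refine ⟨fun k => if hk : ∃ A : Finset (Fin n), A.card = k then μ hk.choose else 0, fun A => ?_⟩
  have hA : ∃ B : Finset (Fin n), B.card = A.card := ⟨A, rfl⟩
  beta_reduce
  rw [dif_pos hA]
  exact h _ _ hA.choose_spec.symm

/-! ### Explicit forms of the Choquet integral of a symmetric capacity -/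

lemma choquet_eq_sum {n : ℕ} {μ : Finset (Fin n) → ℝ} {v : ℕ → ℝ}
    (hμ : ∀ A, μ A = v A.card) {f : Fin n → ℝ} {F : ℕ → ℝ}
    (hF : ∀ i : Fin n, f (Tuple.sort f i) = F i) :
    choquet μ f = ∑ i ∈ range n, (F i - if i = 0 then 0 else F (i - 1)) * v (n - i) := by
  unfold choquet
  rw [Finset.sum_range]
  refine Finset.sum_congr rfl fun i _ => ?_
  rw [hμ, Finset.card_image_of_injective _ (Tuple.sort f).injective]
  have hc : (Finset.univ.filter fun j : Fin n => i ≤ j).card = n - i := by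
    rw [← Fin.card_Ici]
    congr 1
    ext j
    simp
  simp only [hF, hc]

lemma exists_monotone_extension {n : ℕ} (hn : 0 < n) {f : Fin n → ℝ} (hf : Monotone f) :
    ∃ F : ℕ → ℝ, Monotone F ∧ ∀ i : Fin n, f i = F i := by
  refine ⟨fun k => f ⟨min k (n - 1), by omega⟩, fun i j hij => hf ?_, fun i => ?_⟩
  · rw [Fin.mk_le_mk]
    omega
  · congr 1
    ext
    simp only
    omega

lemma exists_sorted_extension {n : ℕ} (hn : 0 < n) (f : Fin n → ℝ) :
    ∃ F : ℕ → ℝ, Monotone F ∧ ∀ i : Fin n, f (Tuple.sort f i) = F i :=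
  exists_monotone_extension hn (Tuple.monotone_sort f)

lemma sort_apply_of_monotone {n : ℕ} {f : Fin n → ℝ} (hf : Monotone f) (i : Fin n) :
    f (Tuple.sort f i) = f i := by
  rw [Tuple.sort_eq_refl_iff_monotone.2 hf, Equiv.refl_apply]

lemma sum_sub_mul_eq_sum_mul_sub (F u : ℕ → ℝ) (m : ℕ) :
    ∑ i ∈ range m, (F i - if i = 0 then 0 else F (i - 1)) * u i =
      ∑ i ∈ range m, F i * (u i - u (i + 1)) + (if m = 0 then 0 else F (m - 1)) * u m := by
  induction m with
  | zero => simp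
  | succ m ih =>
    rw [Finset.sum_range_succ, Finset.sum_range_succ, ih]
    simp only [Nat.add_eq_zero_iff, one_ne_zero, and_false, if_false, Nat.add_sub_cancel]
    ring

lemma choquet_eq_sum_weights {n : ℕ} {μ : Finset (Fin n) → ℝ} {v : ℕ → ℝ}
    (hμ : ∀ A, μ A = v A.card) (hv : v 0 = 0) {f : Fin n → ℝ} {F : ℕ → ℝ}
    (hF : ∀ i : Fin n, f (Tuple.sort f i) = F i) :
    choquet μ f = ∑ i ∈ range n, F i * (v (n - i) - v (n - (i + 1))) := by
  rw [choquet_eq_sum hμ hF, sum_sub_mul_eq_sum_mul_sub F (fun i => v (n - i))]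
  simp [hv]

lemma sum_sum_min_eq (F : ℕ → ℝ) (m : ℕ) :
    ∑ i ∈ range m, ∑ j ∈ range m, F (min i j) =
      ∑ i ∈ range m, F i * (2 * ((m : ℝ) - i) - 1) := by
  induction m with
  | zero => simp
  | succ m ih =>
    rw [Finset.sum_range_succ]
    simp_rw [Finset.sum_range_succ (fun j => F (min _ j)) m]
    rw [Finset.sum_add_distrib, ih, Finset.sum_range_succ _ m]
    have h1 : ∀ i ∈ range m, F (min i m) = F i := fun i hi => by
      rw [min_eq_left (mem_range.1 hi).le]
    have h2 : ∀ i ∈ range m, F (min m i) = F i := fun i hi => by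
      rw [min_eq_right (mem_range.1 hi).le]
    rw [Finset.sum_congr rfl h1, Finset.sum_congr rfl h2, min_self]
    have h3 : ∑ i ∈ range m, F i * (2 * (((m + 1 : ℕ) : ℝ) - i) - 1) =
        ∑ i ∈ range m, F i * (2 * ((m : ℝ) - i) - 1) + 2 * ∑ i ∈ range m, F i := by
      rw [Finset.mul_sum, ← Finset.sum_add_distrib]
      refine Finset.sum_congr rfl fun i _ => ?_
      push_cast
      ring
    rw [h3]
    push_cast
    ring

/-- The linear combination of the sum of `f` and of the sum of its pairwise minima. -/
def pairValue {n : ℕ} (a b : ℝ) (f : Fin n → ℝ) : ℝ :=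
  a * ∑ i, f i + b * ∑ i, ∑ j, min (f i) (f j)

lemma pairValue_comp_perm {n : ℕ} (a b : ℝ) (f : Fin n → ℝ) (π : Equiv.Perm (Fin n)) :
    pairValue a b (f ∘ π) = pairValue a b f := by
  unfold pairValue
  simp only [Function.comp_apply]
  rw [Equiv.sum_comp π f]
  simp only [fun x : ℝ => Equiv.sum_comp π (fun j => min x (f j))]
  rw [Equiv.sum_comp π (fun i => ∑ j, min (f i) (f j))]

lemma choquet_eq_pairValue {n : ℕ} (hn : 0 < n) {μ : Finset (Fin n) → ℝ} {v : ℕ → ℝ} {a b : ℝ}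
    (hμ : ∀ A, μ A = v A.card) (hv : ∀ k ≤ n, v k = a * (k : ℝ) + b * (k : ℝ) ^ 2)
    (f : Fin n → ℝ) : choquet μ f = pairValue a b f := by
  obtain ⟨F, hF, hfF⟩ := exists_sorted_extension hn f
  have hv0 : v 0 = 0 := by simpa using hv 0 (Nat.zero_le _)
  rw [choquet_eq_sum_weights hμ hv0 hfF, ← pairValue_comp_perm a b f (Tuple.sort f)]
  unfold pairValue
  simp only [Function.comp_apply, hfF, ← hF.map_min]
  rw [← Finset.sum_range (fun i => F i)]
  simp only [fun i : ℕ => (Finset.sum_range (n := n) (fun j => F (min i j))).symm]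
  rw [← Finset.sum_range (fun i => ∑ j ∈ range n, F (min i j)), sum_sum_min_eq, Finset.mul_sum,
    Finset.mul_sum, ← Finset.sum_add_distrib]
  refine Finset.sum_congr rfl fun i hi => ?_
  have hi' := mem_range.1 hi
  rw [hv _ (Nat.sub_le _ _), hv _ (Nat.sub_le _ _), Nat.cast_sub hi'.le,
    Nat.cast_sub (show i + 1 ≤ n by omega)]
  push_cast
  ring

lemma sort_apply_le_of_le {n : ℕ} {f g : Fin n → ℝ} (h : ∀ i, g i ≤ f i) (j : Fin n) :
    g (Tuple.sort g j) ≤ f (Tuple.sort f j) := by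
  have hcard : ∀ (k : Fin n → ℝ) (x : ℝ),
      (univ.filter fun i => (k ∘ Tuple.sort k) i ≤ x).card = (univ.filter fun i => k i ≤ x).card :=
    fun k x => Finset.card_bij (fun i _ => Tuple.sort k i) (by simp)
      (fun _ _ _ _ h => (Tuple.sort k).injective h)
      (fun i hi => ⟨(Tuple.sort k).symm i, by simpa using hi, by simp⟩)
  have h1 := (Tuple.lt_card_le_iff_apply_le_of_monotone (j := j)
    (a := f (Tuple.sort f j)) (Tuple.monotone_sort f)).2 le_rfl
  refine (Tuple.lt_card_le_iff_apply_le_of_monotone (Tuple.monotone_sort g)).1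
    (lt_of_lt_of_le h1 ?_)
  rw [hcard, hcard]
  exact Finset.card_le_card fun i hi => by
    simp only [mem_filter, mem_univ, true_and] at hi ⊢
    exact (h i).trans hi

lemma choquet_mono {n : ℕ} (hn : 0 < n) {μ : Finset (Fin n) → ℝ} {v : ℕ → ℝ}
    (hcap : IsCapacity μ) (hμ : ∀ A, μ A = v A.card) {f g : Fin n → ℝ} (h : ∀ i, g i ≤ f i) :
    choquet μ g ≤ choquet μ f := by
  have hv : v 0 = 0 := by rw [← hcap.1, hμ, card_empty]
  obtain ⟨F, -, hF⟩ := exists_sorted_extension hn f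
  obtain ⟨G, -, hG⟩ := exists_sorted_extension hn g
  rw [choquet_eq_sum_weights hμ hv hF, choquet_eq_sum_weights hμ hv hG]
  refine Finset.sum_le_sum fun i hi => mul_le_mul_of_nonneg_right ?_ ?_
  · have := sort_apply_le_of_le h ⟨i, mem_range.1 hi⟩
    rwa [hF, hG] at this
  · rw [sub_nonneg]
    obtain ⟨B, -, hB⟩ := Finset.exists_subset_card_eq
      (s := (Finset.univ : Finset (Fin n))) (n := n - i) (by simp)
    obtain ⟨A, hAB, hA⟩ := Finset.exists_subset_card_eq
      (s := B) (n := n - (i + 1)) (by omega)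
    rw [← hA, ← hB, ← hμ, ← hμ]
    exact hcap.2.2 _ _ hAB

lemma choquet_const {n : ℕ} (hn : 0 < n) {μ : Finset (Fin n) → ℝ} {v : ℕ → ℝ}
    (hcap : IsCapacity μ) (hμ : ∀ A, μ A = v A.card) (c : ℝ) : choquet μ (fun _ => c) = c := by
  have hv : v n = 1 := by rw [← hcap.2.1, hμ, card_univ, Fintype.card_fin]
  rw [choquet_eq_sum hμ (F := fun _ => c) fun _ => rfl,
    Finset.sum_eq_single_of_mem 0 (mem_range.2 hn) fun i _ hi => by simp [hi]]
  simp [hv]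

/-- The act which equals `1` from the index `k` on, and `0` before. -/
def stepAct (n k : ℕ) : Fin n → ℝ := fun i => if k ≤ i then 1 else 0

lemma stepAct_monotone (n k : ℕ) : Monotone (stepAct n k) := by
  intro i j hij
  have : (i : ℕ) ≤ j := hij
  unfold stepAct
  split_ifs
  · exact le_rfl
  · omega
  · exact zero_le_one
  · exact le_rfl

lemma stepAct_nonneg (n k : ℕ) (i : Fin n) : 0 ≤ stepAct n k i := by
  unfold stepAct
  split_ifs <;> norm_num

lemma stepAct_self (n : ℕ) : stepAct n n = fun _ => 0 := by
  ext i
  simp [stepAct]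

lemma choquet_stepAct {n : ℕ} {μ : Finset (Fin n) → ℝ} {v : ℕ → ℝ}
    (hμ : ∀ A, μ A = v A.card) {k : ℕ} (hk : k < n) : choquet μ (stepAct n k) = v (n - k) := by
  rw [choquet_eq_sum hμ (F := fun i => if k ≤ i then 1 else 0)
      fun i => sort_apply_of_monotone (stepAct_monotone n k) i,
    Finset.sum_eq_single_of_mem k (mem_range.2 hk)]
  · rcases Nat.eq_zero_or_pos k with rfl | hk0
    · simp
    · rw [if_pos le_rfl, if_neg hk0.ne', if_neg (by omega), sub_zero, one_mul]
  · intro i _ hi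
    by_cases h0 : i = 0
    · subst h0
      rw [if_neg (by omega)]
      simp
    · rw [if_neg h0]
      by_cases h1 : k ≤ i
      · rw [if_pos h1, if_pos (by omega), sub_self, zero_mul]
      · rw [if_neg h1, if_neg (by omega), sub_self, zero_mul]

lemma eq_of_represents_choquet {n : ℕ} (hn : 0 < n) {R : Pref n} {μ ν : Finset (Fin n) → ℝ}
    (hμ : IsCapacity μ) (hμs : IsSymmetricCap μ) (hμR : Represents (choquet μ) R)
    (hν : IsCapacity ν) (hνs : IsSymmetricCap ν) (hνR : Represents (choquet ν) R) : μ = ν := by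
  obtain ⟨v, hv⟩ := exists_card_form hμs
  obtain ⟨w, hw⟩ := exists_card_form hνs
  have key : ∀ f, choquet μ f = choquet ν f := by
    intro f
    have h1 := choquet_const hn hμ hv (choquet μ f)
    have h2 := choquet_const hn hν hw (choquet μ f)
    have h3 := (hνR _ _).1 ((hμR f _).2 h1.le)
    have h4 := (hνR _ _).1 ((hμR _ f).2 h1.ge)
    linarith
  ext A
  by_cases hA : A.card = 0
  · rw [card_eq_zero.1 hA, hμ.1, hν.1]
  · have hle : A.card ≤ n := by simpa using card_le_univ A
    have h := key (stepAct n (n - A.card))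
    rwa [choquet_stepAct hv (by omega), choquet_stepAct hw (by omega), Nat.sub_sub_self hle,
      ← hv, ← hw] at h

/-! ### The axioms hold for a Choquet integral of an at most 2-additive symmetric capacity -/

lemma pairValue_transfer {n : ℕ} (a b : ℝ) {f f' : Fin n → ℝ} {i j : Fin n} {t : ℝ} (ht : 0 < t)
    (hf : Precedes f i j) (hf' : Precedes f' i j) (hi : f' i = f i + t) (hj : f' j = f j - t)
    (hl : ∀ l, l ≠ i → l ≠ j → f' l = f l) :
    pairValue a b f' = pairValue a b f + b * (2 * t) := by
  have hlt := hf.1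
  have hlt' := hf'.1
  have hij : i ≠ j := by
    rintro rfl
    exact lt_irrefl _ hlt
  rw [hi, hj] at hlt'
  have hside : ∀ l, f l ≤ f i ∨ f j ≤ f l := fun l => by
    by_contra! h
    exact hf.2 l h
  have hpair : ∀ l, l ≠ i ∧ l ≠ j →
      (min (f' i) (f' l) - min (f i) (f l)) + (min (f' j) (f' l) - min (f j) (f l)) = 0 := by
    intro l hne
    rw [hl l hne.1 hne.2, hi, hj]
    rcases hside l with h | h
    · rw [min_eq_right (by linarith), min_eq_right h, min_eq_right (by linarith),
        min_eq_right (by linarith)]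
      ring
    · rw [min_eq_left (by linarith), min_eq_left (by linarith), min_eq_left (by linarith),
        min_eq_left (by linarith)]
      ring
  have hsum : ∑ k, (f' k - f k) = 0 := by
    rw [Fintype.sum_eq_add i j hij fun l hne => by rw [hl l hne.1 hne.2, sub_self], hi, hj]
    ring
  have hmin : ∑ k, ∑ l, (min (f' k) (f' l) - min (f k) (f l)) = 2 * t := by
    rw [Fintype.sum_eq_add i j hij, ← Finset.sum_add_distrib,
      Fintype.sum_eq_add i j hij hpair]
    · rw [hi, hj]
      simp only [min_self]
      rw [min_eq_right (by linarith : f i + t ≤ f j - t), min_eq_right hlt.le,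
        min_eq_left (by linarith : f i + t ≤ f j - t), min_eq_left hlt.le]
      ring
    · intro k hk
      rw [Fintype.sum_eq_add i j hij]
      · rw [min_comm (f' k), min_comm (f k), min_comm (f' k), min_comm (f k)]
        exact hpair k hk
      · intro l hne
        rw [hl l hne.1 hne.2, hl k hk.1 hk.2, sub_self]
  simp only [Finset.sum_sub_distrib] at hsum hmin
  unfold pairValue
  linear_combination a * hsum + b * hmin

lemma pairValue_add {n : ℕ} (a b : ℝ) {f g : Fin n → ℝ} (hf : Monotone f) (hg : Monotone g) :
    pairValue a b (f + g) = pairValue a b f + pairValue a b g := by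
  unfold pairValue
  have h : ∀ i j, min ((f + g) i) ((f + g) j) = min (f i) (f j) + min (g i) (g j) := fun i j => by
    have hfg : Monotone (f + g) := hf.add hg
    rw [← hfg.map_min, ← hf.map_min, ← hg.map_min, Pi.add_apply]
  simp only [h]
  simp only [Pi.add_apply, Finset.sum_add_distrib]
  ring

lemma continuous_pairValue {n : ℕ} (a b : ℝ) :
    Continuous (pairValue a b : (Fin n → ℝ) → ℝ) := by
  unfold pairValue
  fun_prop

lemma axioms_of_represents_choquet {n : ℕ} (hn : 0 < n) {R : Pref n} {μ : Finset (Fin n) → ℝ}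
    (hcap : IsCapacity μ) (hsymm : IsSymmetricCap μ) (hadd : AtMostAdditive 2 μ)
    (hR : Represents (choquet μ) R) :
    AxA1 R ∧ AxA2 R ∧ AxA3 R ∧ AxA4 R ∧ AxA5 R ∧ AxA6 R ∧ AxA7 R := by
  obtain ⟨v, hv⟩ := exists_card_form hsymm
  obtain ⟨a, b, hab⟩ := quadratic_of_atMostAdditive_two hv
    (by rw [← hcap.1, hv, card_empty]) hadd
  have hP := choquet_eq_pairValue hn hv hab
  have hRP : ∀ f g, R f g ↔ pairValue a b g ≤ pairValue a b f := fun f g => by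
    rw [hR, hP, hP]
  refine ⟨⟨fun f g => ?_, fun f => ?_, fun f g h hfg hgh => ?_⟩, fun f => ⟨?_, ?_⟩,
    fun f π => ⟨?_, ?_⟩, fun f g h hf hg hh => ?_, fun f g hfg => ?_, ?_, ?_⟩
  · rw [hRP, hRP]
    exact le_total _ _
  · rw [hRP]
  · rw [hRP] at *
    exact hgh.trans hfg
  · have : {g | StrictP R g f} = {g | pairValue a b f < pairValue a b g} := by
      ext g
      simp only [StrictP, hRP, Set.mem_ofPred_eq, not_le]
      exact ⟨fun h => h.2, fun h => ⟨h.le, h⟩⟩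
    rw [this]
    exact isOpen_lt continuous_const (continuous_pairValue a b)
  · have : {g | StrictP R f g} = {g | pairValue a b g < pairValue a b f} := by
      ext g
      simp only [StrictP, hRP, Set.mem_ofPred_eq, not_le]
      exact ⟨fun h => h.2, fun h => ⟨h.le, h⟩⟩
    rw [this]
    exact isOpen_lt (continuous_pairValue a b) continuous_const
  · rw [hRP, pairValue_comp_perm]
  · rw [hRP, pairValue_comp_perm]
  · rw [hRP, hRP, pairValue_add a b hf hh, pairValue_add a b hg hh]
    exact (add_le_add_iff_right _).symm
  · rw [hR]
    exact choquet_mono hn hcap hv hfg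
  · refine ⟨fun _ => 1, fun _ => 0, ?_, ?_⟩ <;>
      rw [hR, choquet_const hn hcap hv, choquet_const hn hcap hv] <;> norm_num
  · intro f f' g g' i j t ht hf hg hf' hg' hfi hgi hfj hgj hfl hgl
    rw [hRP, hRP, pairValue_transfer a b ht hf hf' hfi hfj hfl,
      pairValue_transfer a b ht hg hg' hgi hgj hgl]
    exact (add_le_add_iff_right _).symm

/-! ### Certainty equivalents -/

lemma not_zero_pref_const {n : ℕ} {R : Pref n} (h1 : AxA1 R) (h4 : AxA4 R) (h5 : AxA5 R)
    (h6 : AxA6 R) {ε : ℝ} (hε : 0 < ε) : ¬ R (fun _ => 0) (fun _ => ε) := by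
  intro h
  obtain ⟨-, hrefl, htrans⟩ := h1
  obtain ⟨f, g, -, hgf⟩ := h6
  have hmul : ∀ k : ℕ, R (fun _ => 0) (fun _ => k * ε) := by
    intro k
    induction k with
    | zero => simpa using hrefl _
    | succ k ih =>
      refine htrans _ _ _ ih ?_
      have := (h4 _ _ (fun _ => k * ε) monotone_const monotone_const monotone_const).1 h
      convert this using 1
      · ext i
        simp
      · ext i
        simp only [Pi.add_apply]
        push_cast
        ring
  have hM : ∀ k : Fin n → ℝ, ∀ i, |k i| ≤ ∑ j, |k j| := fun k i =>
    Finset.single_le_sum (f := fun j => |k j|) (fun j _ => abs_nonneg _) (mem_univ i)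
  obtain ⟨k, hk⟩ := exists_nat_ge ((∑ j, |f j| + ∑ j, |g j|) / ε)
  rw [div_le_iff₀ hε] at hk
  have h0 := (h4 _ _ (fun _ => -∑ j, |g j|) monotone_const monotone_const monotone_const).1
    (hmul k)
  refine hgf (htrans _ _ _ (h5 _ _ fun i => ?_) (htrans _ _ _ h0 (h5 _ _ fun i => ?_)))
  · simp only [Pi.add_apply, zero_add]
    linarith [neg_abs_le (g i), hM g i]
  · simp only [Pi.add_apply]
    linarith [le_abs_self (f i), hM f i]

lemma const_pref_const_iff {n : ℕ} {R : Pref n} (h1 : AxA1 R) (h4 : AxA4 R) (h5 : AxA5 R)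
    (h6 : AxA6 R) (c d : ℝ) : R (fun _ => c) (fun _ => d) ↔ d ≤ c := by
  refine ⟨fun h => ?_, fun h => h5 _ _ fun _ => h⟩
  by_contra! hcd
  refine not_zero_pref_const h1 h4 h5 h6 (sub_pos.2 hcd) ?_
  have := (h4 _ _ (fun _ => -c) monotone_const monotone_const monotone_const).1 h
  convert this using 1
  · ext i
    simp
  · ext i
    simp [sub_eq_add_neg]

lemma exists_certainty_equivalent {n : ℕ} {R : Pref n} (h1 : AxA1 R) (h2 : AxA2 R) (h4 : AxA4 R)
    (h5 : AxA5 R) (h6 : AxA6 R) (f : Fin n → ℝ) : ∃ c : ℝ, IndiffP R f (fun _ => c) := by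
  by_contra! hno
  have hc := const_pref_const_iff h1 h4 h5 h6
  obtain ⟨htot, -, htrans⟩ := h1
  have hcont : Continuous fun c : ℝ => (fun _ => c : Fin n → ℝ) := by fun_prop
  have hM : ∀ i, |f i| ≤ ∑ j, |f j| := fun i =>
    Finset.single_le_sum (f := fun j => |f j|) (fun j _ => abs_nonneg _) (mem_univ i)
  obtain ⟨c, -, hcu, hcv⟩ := (isPreconnected_univ (α := ℝ)) _ _
    ((h2 f).1.preimage hcont) ((h2 f).2.preimage hcont)
    (fun c _ => by
      have := hno c
      simp only [IndiffP, not_and] at this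
      rcases htot f (fun _ => c) with h | h
      · exact Or.inr ⟨h, this h⟩
      · exact Or.inl ⟨h, fun h' => this h' h⟩)
    ⟨∑ j, |f j| + 1, Set.mem_univ _, by
      have h : R (fun _ => ∑ j, |f j|) f := h5 _ _ fun i => (le_abs_self _).trans (hM i)
      have h' : R (fun _ => ∑ j, |f j| + 1) (fun _ => ∑ j, |f j|) := (hc _ _).2 (by linarith)
      refine ⟨htrans _ _ _ h' h, fun hf => ?_⟩
      have := (hc _ _).1 (htrans _ _ _ h hf)
      linarith⟩
    ⟨-∑ j, |f j| - 1, Set.mem_univ _, by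
      have h : R f (fun _ => -∑ j, |f j|) := h5 _ _ fun i => by
        linarith [neg_abs_le (f i), hM i]
      have h' : R (fun _ => -∑ j, |f j|) (fun _ => -∑ j, |f j| - 1) := (hc _ _).2 (by linarith)
      refine ⟨htrans _ _ _ h h', fun hf => ?_⟩
      have := (hc _ _).1 (htrans _ _ _ hf h)
      linarith⟩
  exact hcu.2 hcv.1

lemma exists_additive_representation {n : ℕ} {R : Pref n} (h1 : AxA1 R) (h2 : AxA2 R)
    (h4 : AxA4 R) (h5 : AxA5 R) (h6 : AxA6 R) :
    ∃ V : (Fin n → ℝ) → ℝ, Represents V R ∧ (∀ c, V (fun _ => c) = c) ∧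
      ∀ f g, Monotone f → Monotone g → V (f + g) = V f + V g := by
  have hc := const_pref_const_iff h1 h4 h5 h6
  choose V hV using exists_certainty_equivalent h1 h2 h4 h5 h6
  obtain ⟨-, -, htrans⟩ := h1
  have huniq : ∀ f c, IndiffP R f (fun _ => c) → V f = c := fun f c h =>
    le_antisymm ((hc _ _).1 (htrans _ _ _ h.2 (hV f).1)) ((hc _ _).1 (htrans _ _ _ (hV f).2 h.1))
  refine ⟨V, fun f g => ⟨fun h => ?_, fun h => ?_⟩, fun c => ?_, fun f g hf hg => ?_⟩
  · exact (hc _ _).1 (htrans _ _ _ (hV f).2 (htrans _ _ _ h (hV g).1))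
  · exact htrans _ _ _ (hV f).1 (htrans _ _ _ ((hc _ _).2 h) (hV g).2)
  · exact huniq _ _ ⟨(hc _ _).2 le_rfl, (hc _ _).2 le_rfl⟩
  · refine huniq _ _ ⟨?_, ?_⟩
    · have ha := (h4 _ _ g hf monotone_const hg).1 (hV f).1
      have hb := (h4 _ _ (fun _ => V f) hg monotone_const monotone_const).1 (hV g).1
      rw [add_comm g] at hb
      have hcc := htrans _ _ _ ha hb
      rw [add_comm (fun _ => V g)] at hcc
      exact hcc
    · have ha := (h4 _ _ g monotone_const hf hg).1 (hV f).2
      have hb := (h4 _ _ (fun _ => V f) monotone_const hg monotone_const).1 (hV g).2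
      rw [add_comm g] at hb
      have hcc := htrans _ _ _ hb ha
      rw [add_comm (fun _ => V g)] at hcc
      exact hcc

/-! ### Values of acts under an additive representation -/

section AdditiveValue

variable {n : ℕ} {V : (Fin n → ℝ) → ℝ}

lemma value_smul (hadd : ∀ f g, Monotone f → Monotone g → V (f + g) = V f + V g)
    (hmono : ∀ f g, (∀ i, g i ≤ f i) → V g ≤ V f) (hzero : V (fun _ => 0) = 0)
    {e : Fin n → ℝ} (he : Monotone e) (he0 : ∀ i, 0 ≤ e i) {t : ℝ} (ht : 0 ≤ t) :
    V (t • e) = t * V e := by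
  have hsm : ∀ {s : ℝ}, 0 ≤ s → Monotone (s • e) := fun hs i j hij =>
    mul_le_mul_of_nonneg_left (he hij) hs
  have hnat : ∀ {s : ℝ}, 0 ≤ s → ∀ k : ℕ, V (((k : ℝ) * s) • e) = k * V (s • e) := by
    intro s hs k
    induction k with
    | zero =>
      rw [Nat.cast_zero, zero_mul, zero_mul, zero_smul]
      exact hzero
    | succ k ih =>
      rw [Nat.cast_succ, add_mul, one_mul, add_smul, hadd _ _ (hsm (by positivity)) (hsm hs), ih]
      ring
  have hle : ∀ {r s : ℝ}, r ≤ s → V (r • e) ≤ V (s • e) := fun hrs =>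
    hmono _ _ fun i => mul_le_mul_of_nonneg_right hrs (he0 i)
  have hkey : ∀ k : ℕ, (k : ℝ) * |V (t • e) - t * V e| ≤ V e := by
    intro k
    have hk : (0 : ℝ) ≤ k * t := by positivity
    have hlow := hle (Nat.floor_le hk)
    have hup := hle (Nat.lt_floor_add_one ((k : ℝ) * t)).le
    have hl := hnat zero_le_one ⌊(k : ℝ) * t⌋₊
    have hu := hnat zero_le_one (⌊(k : ℝ) * t⌋₊ + 1)
    push_cast at hu
    rw [mul_one, one_smul] at hl hu
    rw [hnat ht, hl] at hlow
    rw [hnat ht, hu] at hup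
    have he1 : 0 ≤ V e := by
      rw [← hzero]
      exact hmono _ _ he0
    have ha := mul_le_mul_of_nonneg_right (Nat.floor_le hk) he1
    have hb := mul_le_mul_of_nonneg_right (Nat.lt_floor_add_one ((k : ℝ) * t)).le he1
    rw [← abs_of_nonneg (Nat.cast_nonneg (α := ℝ) k), ← abs_mul, abs_le]
    constructor <;> linarith
  by_contra hne
  have hpos : 0 < |V (t • e) - t * V e| := abs_pos.2 (sub_ne_zero.2 hne)
  obtain ⟨k, hk⟩ := exists_nat_gt (V e / |V (t • e) - t * V e|)
  rw [div_lt_iff₀ hpos] at hk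
  exact (hkey k).not_gt hk

lemma value_eq_sum_stepAct (hadd : ∀ f g, Monotone f → Monotone g → V (f + g) = V f + V g)
    (hmono : ∀ f g, (∀ i, g i ≤ f i) → V g ≤ V f) (hconst : ∀ c, V (fun _ => c) = c)
    (hn : 0 < n) {F : ℕ → ℝ} (hF : Monotone F) :
    V (fun i => F i) =
      ∑ i ∈ range n, (F i - if i = 0 then 0 else F (i - 1)) * V (stepAct n i) := by
  have key : ∀ m : ℕ, V (fun j : Fin n => F (min j m)) =
      ∑ i ∈ range (m + 1), (F i - if i = 0 then 0 else F (i - 1)) * V (stepAct n i) := by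
    intro m
    induction m with
    | zero =>
      have h0 : stepAct n 0 = fun _ => 1 := by
        ext i
        simp [stepAct]
      simp [hconst, h0]
    | succ m ih =>
      have hd : 0 ≤ F (m + 1) - F m := sub_nonneg.2 (hF (Nat.le_succ m))
      have hsplit : (fun j : Fin n => F (min j (m + 1))) =
          (fun j : Fin n => F (min j m)) + (F (m + 1) - F m) • stepAct n (m + 1) := by
        ext j
        simp only [Pi.add_apply, Pi.smul_apply, smul_eq_mul, stepAct]
        split_ifs with h
        · rw [min_eq_right h, min_eq_right (by omega)]
          ring
        · rw [min_eq_left (by omega), min_eq_left (by omega)]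
          ring
      rw [Finset.sum_range_succ, ← ih, hsplit, hadd,
        value_smul hadd hmono (hconst 0) (stepAct_monotone _ _) (stepAct_nonneg _ _) hd]
      · simp
      · intro i j hij
        have : (i : ℕ) ≤ j := hij
        exact hF (by omega)
      · exact fun i j hij => mul_le_mul_of_nonneg_left (stepAct_monotone _ _ hij) hd
  have h := key (n - 1)
  rw [Nat.sub_add_cancel hn] at h
  rw [← h]
  congr 1
  ext j
  rw [min_eq_left (by omega)]

end AdditiveValue

/-! ### Consequences of order-preserving transfers -/

/-- The act `l ↦ l` after a transfer of `1 / 4` from the index `q + 1` to the index `q`. -/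
noncomputable def transferAct (n q : ℕ) : Fin n → ℝ :=
  fun l => l + if (l : ℕ) = q then 1 / 4 else if (l : ℕ) = q + 1 then -(1 / 4) else 0

lemma transferAct_add_stepAct (n q : ℕ) :
    transferAct n q + (1 / 2 : ℝ) • stepAct n (q + 1) =
      (fun l : Fin n => ((l : ℕ) : ℝ)) + ((1 / 4 : ℝ) • stepAct n q + (1 / 4 : ℝ) • stepAct n (q + 2)) := by
  ext l
  simp only [transferAct, stepAct, Pi.add_apply, Pi.smul_apply, smul_eq_mul]
  split_ifs <;> first | omega | ring

lemma transferAct_monotone (n q : ℕ) : Monotone (transferAct n q) := by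
  intro i j hij
  rcases hij.eq_or_lt with rfl | hlt
  · exact le_rfl
  · have h : ((i : ℕ) : ℝ) + 1 ≤ (j : ℕ) := by exact_mod_cast hlt
    unfold transferAct
    split_ifs <;> first | omega | linarith

lemma precedes_natCast {n q : ℕ} (hq : q + 1 < n) :
    Precedes (fun l : Fin n => ((l : ℕ) : ℝ)) ⟨q, by omega⟩ ⟨q + 1, hq⟩ := by
  refine ⟨by simp, fun l hl => ?_⟩
  simp only [Nat.cast_lt] at hl
  omega

lemma precedes_transferAct {n q : ℕ} (hq : q + 1 < n) :
    Precedes (transferAct n q) ⟨q, by omega⟩ ⟨q + 1, hq⟩ := by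
  refine ⟨?_, fun l hl => ?_⟩
  · simp only [transferAct, if_true, Nat.add_eq_left, one_ne_zero, if_false]
    push_cast
    linarith
  · simp only [transferAct, if_true, Nat.add_eq_left, one_ne_zero, if_false] at hl
    obtain ⟨h1, h2⟩ := hl
    push_cast at h2
    rcases lt_trichotomy (l : ℕ) q with h | h | h
    · have h' : ((l : ℕ) : ℝ) + 1 ≤ q := by exact_mod_cast h
      rw [if_neg (by omega), if_neg (by omega)] at h1
      linarith
    · rw [if_pos h, h] at h1
      exact lt_irrefl _ h1
    · have h' : (q : ℝ) + 1 ≤ (l : ℕ) := by exact_mod_cast h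
      rw [if_neg (by omega)] at h2
      split_ifs at h2 with h3
      · rw [h3] at h2
        push_cast at h2
        linarith
      · linarith

lemma Precedes.comp_perm {n : ℕ} {f : Fin n → ℝ} {i j : Fin n} {π : Equiv.Perm (Fin n)}
    (h : Precedes f (π i) (π j)) : Precedes (f ∘ π) i j :=
  ⟨h.1, fun l => h.2 (π l)⟩

lemma indiffP_transferAct {n : ℕ} {R : Pref n} (h1 : AxA1 R) (h3 : AxA3 R) (h7 : AxA7 R) {q : ℕ}
    (hq : q + 2 < n) : IndiffP R (transferAct n q) (transferAct n (q + 1)) := by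
  obtain ⟨-, -, htrans⟩ := h1
  let i : Fin n := ⟨q, by omega⟩
  let j : Fin n := ⟨q + 1, by omega⟩
  let k : Fin n := ⟨q + 2, hq⟩
  have hij : i ≠ j := by simp [i, j]
  have hik : i ≠ k := by simp [i, k]
  have hjk : j ≠ k := by simp [j, k]
  let π : Equiv.Perm (Fin n) := Equiv.swap i j * Equiv.swap j k
  have hπi : π i = j := by
    simp only [π, Equiv.Perm.mul_apply]
    rw [Equiv.swap_apply_of_ne_of_ne hij hik, Equiv.swap_apply_left]
  have hπj : π j = k := by
    simp only [π, Equiv.Perm.mul_apply]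
    rw [Equiv.swap_apply_left, Equiv.swap_apply_of_ne_of_ne hik.symm hjk.symm]
  let f : Fin n → ℝ := fun l => (l : ℝ)
  have hf : Precedes f i j := precedes_natCast (by omega)
  have hg : Precedes (f ∘ π) i j := Precedes.comp_perm (by
    rw [hπi, hπj]
    exact precedes_natCast hq)
  have hf' : Precedes (transferAct n q) i j := precedes_transferAct (by omega)
  have hg' : Precedes (transferAct n (q + 1) ∘ π) i j := Precedes.comp_perm (by
    rw [hπi, hπj]
    exact precedes_transferAct hq)
  have hfi : transferAct n q i = f i + 1 / 4 := by simp [transferAct, f, i]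
  have hfj : transferAct n q j = f j - 1 / 4 := by simp [transferAct, f, j, sub_eq_add_neg]
  have hgi : (transferAct n (q + 1) ∘ π) i = (f ∘ π) i + 1 / 4 := by
    simp [transferAct, f, hπi, j]
  have hgj : (transferAct n (q + 1) ∘ π) j = (f ∘ π) j - 1 / 4 := by
    simp [transferAct, f, hπj, k, sub_eq_add_neg]
  have hfl : ∀ l, l ≠ i → l ≠ j → transferAct n q l = f l := fun l hli hlj => by
    have h1 : (l : ℕ) ≠ q := fun h => hli (Fin.ext h)
    have h2 : (l : ℕ) ≠ q + 1 := fun h => hlj (Fin.ext h)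
    simp [transferAct, f, h1, h2]
  have hgl : ∀ l, l ≠ i → l ≠ j → (transferAct n (q + 1) ∘ π) l = (f ∘ π) l :=
    fun l hli hlj => by
      have h1 : (π l : ℕ) ≠ q + 1 := fun h => hli (π.injective ((Fin.ext h).trans hπi.symm))
      have h2 : (π l : ℕ) ≠ q + 1 + 1 := fun h => hlj (π.injective ((Fin.ext h).trans hπj.symm))
      simp [transferAct, f, h1, h2]
  have hto := (h7 f _ (f ∘ π) _ i j (1 / 4) (by norm_num) hf hg hf' hg' hfi hgi hfj hgj hfl
    hgl).1 (h3 f π).1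
  have hfrom := (h7 (f ∘ π) _ f _ i j (1 / 4) (by norm_num) hg hf hg' hf' hgi hfi hgj hfj hgl
    hfl).1 (h3 f π).2
  exact ⟨htrans _ _ _ hto (h3 _ π).2, htrans _ _ _ (h3 _ π).1 hfrom⟩

lemma value_transferAct {n : ℕ} {V : (Fin n → ℝ) → ℝ}
    (hadd : ∀ f g, Monotone f → Monotone g → V (f + g) = V f + V g)
    (hmono : ∀ f g, (∀ i, g i ≤ f i) → V g ≤ V f) (hzero : V (fun _ => 0) = 0) (q : ℕ) :
    V (transferAct n q) = V (fun l => (l : ℝ)) +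
      1 / 4 * (V (stepAct n q) - 2 * V (stepAct n (q + 1)) + V (stepAct n (q + 2))) := by
  have hsm : ∀ {t : ℝ} (k : ℕ), 0 ≤ t → Monotone (t • stepAct n k) := fun k ht i j hij =>
    mul_le_mul_of_nonneg_left (stepAct_monotone _ _ hij) ht
  have hval : ∀ {t : ℝ} (k : ℕ), 0 ≤ t → V (t • stepAct n k) = t * V (stepAct n k) := fun k ht =>
    value_smul hadd hmono hzero (stepAct_monotone _ _) (stepAct_nonneg _ _) ht
  have hid : Monotone fun l : Fin n => ((l : ℕ) : ℝ) := fun i j hij => Nat.cast_le.2 hij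
  have h4 : (0 : ℝ) ≤ 1 / 4 := by norm_num
  have h2 : (0 : ℝ) ≤ 1 / 2 := by norm_num
  have hsum : Monotone ((1 / 4 : ℝ) • stepAct n q + (1 / 4 : ℝ) • stepAct n (q + 2)) :=
    (hsm _ h4).add (hsm _ h4)
  have h := congrArg V (transferAct_add_stepAct n q)
  rw [hadd _ _ (transferAct_monotone n q) (hsm _ h2), hadd _ _ hid hsum,
    hadd _ _ (hsm _ h4) (hsm _ h4), hval _ h2, hval _ h4, hval _ h4] at h
  linarith

lemma quadratic_of_third_difference {n : ℕ} {s : ℕ → ℝ} (hs : s n = 0)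
    (h : ∀ q, q + 2 < n →
      s q - 2 * s (q + 1) + s (q + 2) = s (q + 1) - 2 * s (q + 2) + s (q + 3)) :
    ∃ a b : ℝ, ∀ k ≤ n, s (n - k) = a * (k : ℝ) + b * (k : ℝ) ^ 2 := by
  refine ⟨2 * s (n - 1) - s (n - 2) / 2, s (n - 2) / 2 - s (n - 1), fun k => ?_⟩
  induction k using Nat.strong_induction_on with
  | _ k ih =>
    intro hk
    match k, ih, hk with
    | 0, _, _ => simp [hs]
    | 1, _, _ => push_cast; ring
    | 2, _, _ => push_cast; ring
    | m + 3, ih, hk =>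
      have h0 := h (n - (m + 3)) (by omega)
      have i0 := ih m (by omega) (by omega)
      have i1 := ih (m + 1) (by omega) (by omega)
      have i2 := ih (m + 2) (by omega) (by omega)
      rw [show n - (m + 3) + 1 = n - (m + 2) by omega,
        show n - (m + 3) + 2 = n - (m + 1) by omega,
        show n - (m + 3) + 3 = n - m by omega, i0, i1, i2] at h0
      push_cast at h0 ⊢
      linear_combination h0

lemma exists_capacity_of_axioms {n : ℕ} (hn : 0 < n) {R : Pref n} (h1 : AxA1 R) (h2 : AxA2 R)
    (h3 : AxA3 R) (h4 : AxA4 R) (h5 : AxA5 R) (h6 : AxA6 R) (h7 : AxA7 R) :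
    ∃ μ : Finset (Fin n) → ℝ, IsCapacity μ ∧ IsSymmetricCap μ ∧ AtMostAdditive 2 μ ∧
      Represents (choquet μ) R := by
  obtain ⟨V, hR, hconst, hadd⟩ := exists_additive_representation h1 h2 h4 h5 h6
  have hmono : ∀ f g, (∀ i, g i ≤ f i) → V g ≤ V f := fun f g h => (hR _ _).1 (h5 _ _ h)
  have hindiff : ∀ {f g}, IndiffP R f g → V f = V g := fun h =>
    le_antisymm ((hR _ _).1 h.2) ((hR _ _).1 h.1)
  have hn0 : V (stepAct n n) = 0 := by rw [stepAct_self, hconst]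
  obtain ⟨a, b, hab⟩ := quadratic_of_third_difference (s := fun k => V (stepAct n k)) hn0
    fun q hq => by
      have h := hindiff (indiffP_transferAct h1 h3 h7 hq)
      rw [value_transferAct hadd hmono (hconst 0), value_transferAct hadd hmono (hconst 0)] at h
      linarith
  have hchoquet : ∀ f, choquet (fun A => V (stepAct n (n - A.card))) f = V f := by
    intro f
    obtain ⟨F, hF, hfF⟩ := exists_sorted_extension hn f
    rw [choquet_eq_sum (v := fun k => V (stepAct n (n - k))) (fun _ => rfl) hfF,
      hindiff (h3 f (Tuple.sort f)),
      show f ∘ Tuple.sort f = fun i : Fin n => F i from funext hfF,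
      value_eq_sum_stepAct hadd hmono hconst hn hF]
    refine Finset.sum_congr rfl fun i hi => ?_
    rw [Nat.sub_sub_self (mem_range.1 hi).le]
  refine ⟨fun A => V (stepAct n (n - A.card)), ⟨?_, ?_, fun A B hAB => hmono _ _ fun i => ?_⟩,
    fun A B hAB => ?_, atMostAdditive_two_of_quadratic fun A => hab _ ?_, fun f g => ?_⟩
  · beta_reduce
    rw [card_empty, Nat.sub_zero, hn0]
  · have h0 : stepAct n 0 = fun _ => 1 := by
      ext i
      simp [stepAct]
    beta_reduce
    rw [card_univ, Fintype.card_fin, Nat.sub_self, h0, hconst]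
  · have := card_le_card hAB
    unfold stepAct
    split_ifs <;> first | omega | norm_num
  · beta_reduce
    rw [hAB]
  · simpa using card_le_univ A
  · rw [hchoquet, hchoquet]
    exact hR f g

/-- characterization of preferences represented by the Choquet integral of an
at most 2-additive symmetric capacity (A1–A7). -/
theorem stmt_6 (n : ℕ) (hn : 2 ≤ n) (R : Pref n) :
    (AxA1 R ∧ AxA2 R ∧ AxA3 R ∧ AxA4 R ∧ AxA5 R ∧ AxA6 R ∧ AxA7 R) ↔
    (∃! μ : Finset (Fin n) → ℝ, IsCapacity μ ∧ IsSymmetricCap μ ∧ AtMostAdditive 2 μ ∧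
      Represents (choquet μ) R) := by
  have hn0 : 0 < n := by omega
  constructor
  · rintro ⟨h1, h2, h3, h4, h5, h6, h7⟩
    obtain ⟨μ, hcap, hsymm, hadd, hR⟩ := exists_capacity_of_axioms hn0 h1 h2 h3 h4 h5 h6 h7
    exact ⟨μ, ⟨hcap, hsymm, hadd, hR⟩, fun ν ⟨hν, hνs, _, hνR⟩ =>
      eq_of_represents_choquet hn0 hν hνs hνR hcap hsymm hR⟩
  · rintro ⟨μ, ⟨hcap, hsymm, hadd, hR⟩, -⟩
    exact axioms_of_represents_choquet hn0 hcap hsymm hadd hR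
end

section
/- Let n ≥ 2, let w ∈ ℝ^n be a weight vector (w_i ≥ 0, Σ_i w_i = 1), and let ≽ be the preference relation on ℝ^n represented by OWA_w. Then ≽ satisfies axiom A8 (inequality aversion): for every nondecreasing act f (f_1 ≤ … ≤ f_n), every i ∈ {1,…,n−1} and every t > 0 such that the act f' defined by f'_i = f_i + t, f'_{i+1} = f_{i+1} − t and f'_j = f_j for j ≠ i, i+1 is still nondecreasing, one has f' ≻ f — if and only if the weights are strictly decreasing: w_1 > w_2 > ⋯ > w_n. -/
open Finset

lemma owa_eq_of_monotone {n : ℕ} (w : Fin n → ℝ) {f : Fin n → ℝ} (hf : Monotone f) :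
    owa w f = ∑ i, w i * f i := by
  have h : f ∘ Tuple.sort f = f := Tuple.comp_sort_eq_comp_iff_monotone (σ := 1) |>.mpr hf |>.symm
  exact Finset.sum_congr rfl fun i _ => congrArg (w i * ·) (congrFun h i)

/-- A transfer of `t` from coordinate `j` to coordinate `i` that keeps the act nondecreasing
changes its OWA value by `t * (w i - w j)`. -/
lemma owa_sub_owa_of_transfer {n : ℕ} (w : Fin n → ℝ) {f f' : Fin n → ℝ} (hf : Monotone f)
    (hf' : Monotone f') {i j : Fin n} (hij : i ≠ j) {t : ℝ} (hi : f' i = f i + t)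
    (hj : f' j = f j - t) (h : ∀ k, k ≠ i → k ≠ j → f' k = f k) :
    owa w f' - owa w f = t * (w i - w j) := by
  rw [owa_eq_of_monotone w hf, owa_eq_of_monotone w hf', ← Finset.sum_sub_distrib,
    Fintype.sum_eq_add i j hij fun k hk => by rw [h k hk.1 hk.2, sub_self], hi, hj]
  ring

/-- The preference represented by `V` ranks `f` strictly above `g` iff `V g < V f`. -/
lemma Represents.strictP_iff {n : ℕ} {V : (Fin n → ℝ) → ℝ} {R : Pref n} (hR : Represents V R)
    (f g : Fin n → ℝ) : StrictP R f g ↔ V g < V f := by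
  rw [StrictP, hR, hR, not_le]
  exact ⟨And.right, fun h => ⟨h.le, h⟩⟩

/-- for a preference represented by `OWA_w`, A8 (inequality aversion) is
equivalent to strictly decreasing weights. -/
theorem stmt_7 (n : ℕ) (hn : 2 ≤ n) (w : Fin n → ℝ) (hw0 : ∀ i, 0 ≤ w i)
    (hw1 : ∑ i, w i = 1) (R : Pref n) (hR : Represents (owa w) R) :
    AxA8 R ↔ (∀ i : ℕ, i + 1 < n → wAt w (i + 1) < wAt w i) := by
  constructor
  · intro h i hi
    have hin : i < n := by omega
    let f : Fin n → ℝ := fun k => 2 * k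
    let f' : Fin n → ℝ := fun k =>
      if (k : ℕ) = i then 2 * i + 1 else if (k : ℕ) = i + 1 then 2 * i + 1 else 2 * k
    have hf : Monotone f := fun a b hab => by
      have : (a : ℝ) ≤ b := by exact_mod_cast hab
      simp only [f]
      linarith
    have hf' : Monotone f' := fun a b hab => by
      have hab' : (a : ℕ) ≤ b := hab
      simp only [f']
      split_ifs <;> norm_cast <;> omega
    have hfi : f' ⟨i, hin⟩ = f ⟨i, hin⟩ + 1 := by simp [f, f']
    have hfj : f' ⟨i + 1, hi⟩ = f ⟨i + 1, hi⟩ - 1 := by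
      simp [f, f']
      ring
    have hfk : ∀ k, k ≠ ⟨i, hin⟩ → k ≠ ⟨i + 1, hi⟩ → f' k = f k := fun k hk hk' => by
      simp only [ne_eq, Fin.ext_iff] at hk hk'
      simp [f, f', hk, hk']
    have hlt := (hR.strictP_iff _ _).1 (h f f' hf hf' ⟨i, hin⟩ hi 1 one_pos hfi hfj hfk)
    have heq := owa_sub_owa_of_transfer w hf hf' (by simp) hfi hfj hfk
    simp only [wAt, hin, hi, dif_pos]
    linarith
  · intro h f f' hf hf' i hi t ht hfi hfj hfk
    have heq := owa_sub_owa_of_transfer w hf hf' (by simp [Fin.ext_iff]) hfi hfj hfk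
    have hw := h i hi
    simp only [wAt, hi, i.isLt, dif_pos] at hw
    rw [hR.strictP_iff, ← sub_pos, heq]
    exact mul_pos ht (sub_pos.2 hw)
end
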